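/- Under the randomized double-oral-auction mechanism (Mechanism 2 with bounded increment ε and uniformly random recognition among active agents), if at time t₁ there is an active pair, i.e., an edge (B,S) with both B and S unmatched and P(B) ≥ P(S), then with probability at least 1 − 1/n² the number of active agents strictly decreases within 2n·log n steps. -/

import Mathlib

open Finset

/-- A market: buyers `B`, sellers `S`, trading edges `E`, valuations in `[0,1]`. -/
structure Market (B S : Type*) [Fintype B] [Fintype S] where
  E : Finset (B × S)
  valB : B → ℝ
  valS : S → ℝ
  valB_nonneg : ∀ b, 0 ≤ valB b
  valB_le_one : ∀ b, valB b ≤ 1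
  valS_nonneg : ∀ s, 0 ≤ valS s
  valS_le_one : ∀ s, valS s ≤ 1

/-- A state of the market: prices submitted by buyers and sellers, and a matching. -/
structure MState (B S : Type*) where
  PB : B → ℝ
  PS : S → ℝ
  M : Finset (B × S)

variable {B S : Type*} [Fintype B] [Fintype S]

/-- `Mat` is a matching contained in the edge set. -/
def IsMatching (Mk : Market B S) (Mat : Finset (B × S)) : Prop :=
  Mat ⊆ Mk.E ∧ (∀ p ∈ Mat, ∀ q ∈ Mat, p.1 = q.1 → p = q) ∧
    (∀ p ∈ Mat, ∀ q ∈ Mat, p.2 = q.2 → p = q)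

def BMatched (st : MState B S) (b : B) : Prop := ∃ s, (b, s) ∈ st.M
def SMatched (st : MState B S) (s : S) : Prop := ∃ b, (b, s) ∈ st.M

/-- A valid state: bids below valuations, offers above opportunity costs,
and within a matched pair the bid is at least the offer. -/
def ValidState (Mk : Market B S) (st : MState B S) : Prop :=
  IsMatching Mk st.M ∧ (∀ b, st.PB b ≤ Mk.valB b) ∧ (∀ s, Mk.valS s ≤ st.PS s) ∧
    ∀ p ∈ st.M, st.PS p.2 ≤ st.PB p.1

/-- Social welfare of a matching. -/
def SW (Mk : Market B S) (Mat : Finset (B × S)) : ℝ :=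
  ∑ p ∈ Mat, (Mk.valB p.1 - Mk.valS p.2)

/-- Stable state: no bid above an offer on any edge, unmatched agents submit their
valuations, matched pairs have equal prices. -/
def IsStable (Mk : Market B S) (st : MState B S) : Prop :=
  (∀ p ∈ Mk.E, st.PB p.1 ≤ st.PS p.2) ∧
  (∀ b, ¬ BMatched st b → st.PB b = Mk.valB b) ∧
  (∀ s, ¬ SMatched st s → st.PS s = Mk.valS s) ∧
  ∀ p ∈ st.M, st.PB p.1 = st.PS p.2

/-- ε-stable state. -/
def IsEpsStable (Mk : Market B S) (ε : ℝ) (st : MState B S) : Prop :=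
  (∀ p ∈ Mk.E, st.PB p.1 - st.PS p.2 ≤ ε) ∧
  (∀ b, ¬ BMatched st b → st.PB b = Mk.valB b) ∧
  (∀ s, ¬ SMatched st s → st.PS s = Mk.valS s) ∧
  ∀ p ∈ st.M, st.PB p.1 = st.PS p.2

/-- `x` is an integer multiple of `ε`. -/
def MulEps (ε x : ℝ) : Prop := ∃ k : ℤ, x = k * ε

variable [DecidableEq B] [DecidableEq S]

/-- Seller `s` is ε-interested in buyer `b` (at b's current bid). -/
def SellerInterested (Mk : Market B S) (ε : ℝ) (st : MState B S) (b : B) (s : S) : Prop :=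
  (b, s) ∈ Mk.E ∧
    ((¬ SMatched st s ∧ st.PS s ≤ st.PB b) ∨ (SMatched st s ∧ st.PS s + ε ≤ st.PB b))

/-- Buyer `b` is ε-interested in seller `s` (at s's current offer). -/
def BuyerInterested (Mk : Market B S) (ε : ℝ) (st : MState B S) (s : S) (b : B) : Prop :=
  (b, s) ∈ Mk.E ∧
    ((¬ BMatched st b ∧ st.PS s ≤ st.PB b) ∨ (BMatched st b ∧ st.PS s + ε ≤ st.PB b))

/-- Match `b` with `s` at price `price`, displacing previous partners and equalizing
the two submitted prices. -/
def matchPair (st : MState B S) (b : B) (s : S) (price : ℝ) : MState B S where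
  PB := Function.update st.PB b price
  PS := Function.update st.PS s price
  M := insert (b, s) (st.M.filter fun p => p.1 ≠ b ∧ p.2 ≠ s)

/-- One legal move of the recognized agent `z` in Mechanism 2: an unmatched agent either
changes his price by exactly `ε` (bounded increment, respecting rationality and the
increment rule) or, keeping his price, matches with an ε-interested counterpart,
giving priority to unmatched counterparts. -/
inductive Move2 (Mk : Market B S) (ε : ℝ) : MState B S → B ⊕ S → MState B S → Prop
  | buyRaise (st : MState B S) (b : B) :
      ¬ BMatched st b → st.PB b + ε ≤ Mk.valB b →
      (∀ s, (b, s) ∈ Mk.E → st.PB b + ε ≤ st.PS s + ε) →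
      (∀ s, (b, s) ∈ Mk.E → ¬ SMatched st s → st.PB b + ε ≤ st.PS s) →
      Move2 Mk ε st (Sum.inl b) ⟨Function.update st.PB b (st.PB b + ε), st.PS, st.M⟩
  | buyMatch (st : MState B S) (b : B) (s : S) :
      ¬ BMatched st b →
      SellerInterested Mk ε st b s →
      ((∃ s₀, SellerInterested Mk ε st b s₀ ∧ ¬ SMatched st s₀) → ¬ SMatched st s) →
      Move2 Mk ε st (Sum.inl b) (matchPair st b s (st.PB b))
  | sellLower (st : MState B S) (s : S) :
      ¬ SMatched st s → Mk.valS s ≤ st.PS s - ε →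
      (∀ b, (b, s) ∈ Mk.E → st.PB b - ε ≤ st.PS s - ε) →
      (∀ b, (b, s) ∈ Mk.E → ¬ BMatched st b → st.PB b ≤ st.PS s - ε) →
      Move2 Mk ε st (Sum.inr s) ⟨st.PB, Function.update st.PS s (st.PS s - ε), st.M⟩
  | sellMatch (st : MState B S) (s : S) (b : B) :
      ¬ SMatched st s →
      BuyerInterested Mk ε st s b →
      ((∃ b₀, BuyerInterested Mk ε st s b₀ ∧ ¬ BMatched st b₀) → ¬ BMatched st b) →
      Move2 Mk ε st (Sum.inr s) (matchPair st b s (st.PS s))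

/-- The set of active agents: those having some legal move. -/
noncomputable def activeSet (Mk : Market B S) (ε : ℝ) (st : MState B S) : Finset (B ⊕ S) :=
  @Finset.filter _ (fun z => ∃ st', Move2 Mk ε st z st') (Classical.decPred _) Finset.univ

/-- Number of active agents. -/
noncomputable def activeCount (Mk : Market B S) (ε : ℝ) (st : MState B S) : ℕ :=
  (activeSet Mk ε st).card

/-- A strategy is legal if whenever an active agent is recognized, he makes a legal move. -/
def LegalStrategy (Mk : Market B S) (ε : ℝ) (σ : MState B S → B ⊕ S → MState B S) : Prop :=
  ∀ st z, z ∈ activeSet Mk ε st → Move2 Mk ε st z (σ st z)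

/-- One round of Mechanism 2: recognize an active agent uniformly at random and let him
move according to the strategy `σ`; if no agent is active the state is unchanged. -/
noncomputable def stepPMF (Mk : Market B S) (ε : ℝ)
    (σ : MState B S → B ⊕ S → MState B S) (st : MState B S) : PMF (MState B S) :=
  if h : (activeSet Mk ε st).Nonempty then
    (PMF.uniformOfFinset _ h).map (σ st)
  else PMF.pure st

instance : Inhabited (MState B S) := ⟨⟨fun _ => 0, fun _ => 0, ∅⟩⟩

/-- Distribution of the reversed trajectory of the first `T` rounds (most recent state
first, so `List.headI` is the current state). -/
noncomputable def pathPMF (Mk : Market B S) (ε : ℝ)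
    (σ : MState B S → B ⊕ S → MState B S) (st₀ : MState B S) :
    ℕ → PMF (List (MState B S))
  | 0 => PMF.pure [st₀]
  | T + 1 => (pathPMF Mk ε σ st₀ T).bind fun l => (stepPMF Mk ε σ l.headI).map (· :: l)

/-- There is an active pair: an edge with both endpoints unmatched and bid ≥ offer. -/
def HasActivePair (Mk : Market B S) (st : MState B S) : Prop :=
  ∃ p ∈ Mk.E, ¬ BMatched st p.1 ∧ ¬ SMatched st p.2 ∧ st.PS p.2 ≤ st.PB p.1

/-- Invariants of states arising while running Mechanism 2 from a valid start. -/
def GoodState (Mk : Market B S) (ε : ℝ) (st : MState B S) : Prop :=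
  ValidState Mk st ∧ (∀ p ∈ Mk.E, st.PB p.1 - st.PS p.2 ≤ ε) ∧
  (∀ b, 0 ≤ st.PB b) ∧ (∀ s, st.PS s ≤ 1) ∧
  (∀ b, MulEps ε (st.PB b)) ∧ (∀ s, MulEps ε (st.PS s))

set_option linter.unusedSectionVars false

/-- The agent `z` is unmatched in `st`. -/
def Unmatched (st : MState B S) : B ⊕ S → Prop :=
  Sum.elim (fun b => ¬ BMatched st b) (fun s => ¬ SMatched st s)

/-- No agent belongs to two pairs of `Mat`. -/
def PairsDisjoint (Mat : Finset (B × S)) : Prop :=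
  (∀ p ∈ Mat, ∀ q ∈ Mat, p.1 = q.1 → p = q) ∧ ∀ p ∈ Mat, ∀ q ∈ Mat, p.2 = q.2 → p = q

/-- `st'` arises from `st` by matching two previously unmatched agents. -/
def NewMatch (Mk : Market B S) (st st' : MState B S) (b : B) (s : S) : Prop :=
  (b, s) ∈ Mk.E ∧ ¬ BMatched st b ∧ ¬ SMatched st s ∧ st.PS s ≤ st.PB b ∧
    ∃ price, st' = matchPair st b s price

/-- `z` is unmatched, cannot profitably change his price, still has the price of `st₀`, and
has no strictly profitable counterpart. -/
def Settled (Mk : Market B S) (ε : ℝ) (st₀ st : MState B S) : B ⊕ S → Prop :=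
  Sum.elim
    (fun b => ¬ BMatched st b ∧ Mk.valB b < st.PB b + ε ∧ st.PB b = st₀.PB b ∧
      ∀ s, (b, s) ∈ Mk.E → st.PB b ≤ st.PS s)
    (fun s => ¬ SMatched st s ∧ st.PS s - ε < Mk.valS s ∧ st.PS s = st₀.PS s ∧
      ∀ b, (b, s) ∈ Mk.E → st.PB b ≤ st.PS s)

theorem bMatched_matchPair {st : MState B S} {b b' : B} {s : S} {price : ℝ} :
    BMatched (matchPair st b s price) b' ↔
      b' = b ∨ ∃ s', (b', s') ∈ st.M ∧ b' ≠ b ∧ s' ≠ s := by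
  simp only [BMatched, matchPair, mem_insert, mem_filter, Prod.mk.injEq]
  constructor
  · rintro ⟨s', h | h⟩
    · exact Or.inl h.1
    · exact Or.inr ⟨s', h⟩
  · rintro (h | ⟨s', h⟩)
    · exact ⟨s, Or.inl ⟨h, rfl⟩⟩
    · exact ⟨s', Or.inr h⟩

theorem sMatched_matchPair {st : MState B S} {b : B} {s s' : S} {price : ℝ} :
    SMatched (matchPair st b s price) s' ↔
      s' = s ∨ ∃ b', (b', s') ∈ st.M ∧ b' ≠ b ∧ s' ≠ s := by
  simp only [SMatched, matchPair, mem_insert, mem_filter, Prod.mk.injEq]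
  constructor
  · rintro ⟨b', h | h⟩
    · exact Or.inl h.2
    · exact Or.inr ⟨b', h⟩
  · rintro (h | ⟨b', h⟩)
    · exact ⟨b, Or.inl ⟨rfl, h⟩⟩
    · exact ⟨b', Or.inr h⟩

theorem SellerInterested.offer_le_bid {Mk : Market B S} {ε : ℝ} (hε : 0 < ε) {st : MState B S}
    {b : B} {s : S} (h : SellerInterested Mk ε st b s) : st.PS s ≤ st.PB b := by
  rcases h.2 with h | h <;> linarith [h.2]

theorem BuyerInterested.offer_le_bid {Mk : Market B S} {ε : ℝ} (hε : 0 < ε) {st : MState B S}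
    {b : B} {s : S} (h : BuyerInterested Mk ε st s b) : st.PS s ≤ st.PB b := by
  rcases h.2 with h | h <;> linarith [h.2]

theorem Move2.unmatched {Mk : Market B S} {ε : ℝ} {st st' : MState B S} {z : B ⊕ S}
    (h : Move2 Mk ε st z st') : Unmatched st z := by
  cases h <;> simpa [Unmatched]

theorem exists_buyer_move {Mk : Market B S} {ε : ℝ} {st : MState B S} {b : B} {s : S}
    (hb : ¬ BMatched st b) (h : SellerInterested Mk ε st b s) :
    ∃ st', Move2 Mk ε st (Sum.inl b) st' := by
  by_cases h₀ : ∃ s₀, SellerInterested Mk ε st b s₀ ∧ ¬ SMatched st s₀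
  · obtain ⟨s₀, h₁, h₂⟩ := h₀
    exact ⟨_, .buyMatch st b s₀ hb h₁ fun _ => h₂⟩
  · exact ⟨_, .buyMatch st b s hb h fun h₁ => (h₀ h₁).elim⟩

theorem exists_seller_move {Mk : Market B S} {ε : ℝ} {st : MState B S} {b : B} {s : S}
    (hs : ¬ SMatched st s) (h : BuyerInterested Mk ε st s b) :
    ∃ st', Move2 Mk ε st (Sum.inr s) st' := by
  by_cases h₀ : ∃ b₀, BuyerInterested Mk ε st s b₀ ∧ ¬ BMatched st b₀
  · obtain ⟨b₀, h₁, h₂⟩ := h₀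
    exact ⟨_, .sellMatch st s b₀ hs h₁ fun _ => h₂⟩
  · exact ⟨_, .sellMatch st s b hs h fun h₁ => (h₀ h₁).elim⟩

theorem Move2.settled {Mk : Market B S} {ε : ℝ} (hε : 0 < ε) {st₀ st st' : MState B S}
    {z y : B ⊕ S} (h : Move2 Mk ε st z st') (hy : Settled Mk ε st₀ st y)
    (hu : Unmatched st' y) : Settled Mk ε st₀ st' y := by
  rcases y with b' | s' <;> obtain ⟨h₁, h₂, h₃, h₄⟩ := hy <;> refine ⟨hu, ?_⟩
  · cases h with
    | buyRaise b hb hv hE hE' =>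
      have hne : b' ≠ b := by rintro rfl; linarith
      simpa [hne] using ⟨h₂, h₃, h₄⟩
    | buyMatch b s hb hi hp =>
      have hne : b' ≠ b := fun e => hu (bMatched_matchPair.2 (Or.inl e))
      have hle := hi.offer_le_bid hε
      simp only [matchPair, Function.update_of_ne hne]
      refine ⟨h₂, h₃, fun s'' hs'' => ?_⟩
      rcases eq_or_ne s'' s with rfl | hs
      · simpa using (h₄ _ hs'').trans hle
      · simpa [hs] using h₄ _ hs''
    | sellLower s hs hv hE hE' =>
      refine ⟨h₂, h₃, fun s'' hs'' => ?_⟩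
      rcases eq_or_ne s'' s with rfl | hs
      · simpa using hE' _ hs'' h₁
      · simpa [hs] using h₄ _ hs''
    | sellMatch s b hs hi hp =>
      have hne : b' ≠ b := fun e => hu (bMatched_matchPair.2 (Or.inl e))
      simpa [matchPair, hne] using ⟨h₂, h₃, h₄⟩
  · cases h with
    | buyRaise b hb hv hE hE' =>
      refine ⟨h₂, h₃, fun b'' hb'' => ?_⟩
      rcases eq_or_ne b'' b with rfl | hs
      · simpa using hE' _ hb'' h₁
      · simpa [hs] using h₄ _ hb''
    | buyMatch b s hb hi hp =>
      have hne : s' ≠ s := fun e => hu (sMatched_matchPair.2 (Or.inl e))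
      simpa [matchPair, hne] using ⟨h₂, h₃, h₄⟩
    | sellLower s hs hv hE hE' =>
      have hne : s' ≠ s := by rintro rfl; linarith
      simpa [hne] using ⟨h₂, h₃, h₄⟩
    | sellMatch s b hs hi hp =>
      have hne : s' ≠ s := fun e => hu (sMatched_matchPair.2 (Or.inl e))
      have hle := hi.offer_le_bid hε
      simp only [matchPair, Function.update_of_ne hne]
      refine ⟨h₂, h₃, fun b'' hb'' => ?_⟩
      rcases eq_or_ne b'' b with rfl | hb
      · simpa using hle.trans (h₄ _ hb'')
      · simpa [hb] using h₄ _ hb''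

theorem NewMatch.unmatched {Mk : Market B S} {st st' : MState B S} {b : B} {s : S}
    (h : NewMatch Mk st st' b s) {y : B ⊕ S} (hy : Unmatched st y) (hb : y ≠ Sum.inl b)
    (hs : y ≠ Sum.inr s) : Unmatched st' y := by
  obtain ⟨-, -, -, -, price, rfl⟩ := h
  rcases y with b' | s'
  · rintro h
    rcases bMatched_matchPair.1 h with h | ⟨s', h, -⟩
    · exact hb (congrArg _ h)
    · exact hy ⟨s', h⟩
  · rintro h
    rcases sMatched_matchPair.1 h with h | ⟨b', h, -⟩
    · exact hs (congrArg _ h)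
    · exact hy ⟨b', h⟩

/-- A move that creates no match between two unmatched agents can only match the mover,
and only when he has a strictly profitable counterpart. -/
theorem Move2.unmatched_of_not_newMatch {Mk : Market B S} {ε : ℝ} {st st' : MState B S}
    {z y : B ⊕ S} (h : Move2 Mk ε st z st') (hn : ∀ b s, ¬ NewMatch Mk st st' b s)
    (hy : Unmatched st y)
    (hb : ∀ b, y = Sum.inl b → y = z → (∀ s, (b, s) ∈ Mk.E → SMatched st s →
      st.PB b < st.PS s + ε) ∨ ∃ s, SellerInterested Mk ε st b s ∧ ¬ SMatched st s)
    (hs : ∀ s, y = Sum.inr s → y = z → (∀ b, (b, s) ∈ Mk.E → BMatched st b →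
      st.PB b < st.PS s + ε) ∨ ∃ b, BuyerInterested Mk ε st s b ∧ ¬ BMatched st b) :
    Unmatched st' y := by
  cases h with
  | buyRaise b _ _ _ _ => exact hy
  | sellLower s _ _ _ _ => exact hy
  | buyMatch b s hbu hi hp =>
    rcases hi.2 with hi' | hi'
    · exact (hn b s ⟨hi.1, hbu, hi'.1, hi'.2, _, rfl⟩).elim
    rcases y with b' | s'
    · intro hm
      rcases bMatched_matchPair.1 hm with rfl | ⟨s', h, -⟩
      · rcases hb _ rfl rfl with h | h
        · linarith [h s hi.1 hi'.1, hi'.2]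
        · exact hp h hi'.1
      · exact hy ⟨s', h⟩
    · intro hm
      rcases sMatched_matchPair.1 hm with rfl | ⟨b', h, -⟩
      · exact hy hi'.1
      · exact hy ⟨b', h⟩
  | sellMatch s b hsu hi hp =>
    rcases hi.2 with hi' | hi'
    · exact (hn b s ⟨hi.1, hi'.1, hsu, hi'.2, _, rfl⟩).elim
    rcases y with b' | s'
    · intro hm
      rcases bMatched_matchPair.1 hm with rfl | ⟨s', h, -⟩
      · exact hy hi'.1
      · exact hy ⟨s', h⟩
    · intro hm
      rcases sMatched_matchPair.1 hm with rfl | ⟨b', h, -⟩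
      · rcases hs _ rfl rfl with h | h
        · linarith [h b hi.1 hi'.1, hi'.2]
        · exact hp h hi'.1
      · exact hy ⟨b', h⟩

theorem PairsDisjoint.matchPair {st : MState B S} (h : PairsDisjoint st.M) (b : B) (s : S)
    (price : ℝ) : PairsDisjoint (matchPair st b s price).M := by
  constructor
  · intro p hp q hq e
    simp only [_root_.matchPair, mem_insert, mem_filter] at hp hq
    rcases hp with rfl | hp <;> rcases hq with rfl | hq
    · rfl
    · exact (hq.2.1 e.symm).elim
    · exact (hp.2.1 e).elim
    · exact h.1 p hp.1 q hq.1 e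
  · intro p hp q hq e
    simp only [_root_.matchPair, mem_insert, mem_filter] at hp hq
    rcases hp with rfl | hp <;> rcases hq with rfl | hq
    · rfl
    · exact (hq.2.2 e.symm).elim
    · exact (hp.2.2 e).elim
    · exact h.2 p hp.1 q hq.1 e

theorem Move2.pairsDisjoint {Mk : Market B S} {ε : ℝ} {st st' : MState B S} {z : B ⊕ S}
    (h : Move2 Mk ε st z st') (hM : PairsDisjoint st.M) : PairsDisjoint st'.M := by
  cases h
  · exact hM
  · exact hM.matchPair _ _ _
  · exact hM
  · exact hM.matchPair _ _ _

theorem NewMatch.card {Mk : Market B S} {st st' : MState B S} {b : B} {s : S}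
    (h : NewMatch Mk st st' b s) : st'.M.card = st.M.card + 1 := by
  obtain ⟨-, hb, hs, -, price, rfl⟩ := h
  have hf : st.M.filter (fun p => p.1 ≠ b ∧ p.2 ≠ s) = st.M :=
    filter_true_of_mem fun p hp =>
      ⟨fun e => hb ⟨p.2, e ▸ hp⟩, fun e => hs ⟨p.1, e ▸ hp⟩⟩
  simp only [matchPair, hf]
  exact card_insert_of_notMem fun h => hb ⟨s, h⟩

theorem card_le_card_matchPair {st : MState B S} {b : B} {s : S} (price : ℝ)
    (hM : PairsDisjoint st.M) (h : ¬ BMatched st b ∨ ¬ SMatched st s) :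
    st.M.card ≤ (matchPair st b s price).M.card := by
  have hni : (b, s) ∉ st.M.filter fun p => p.1 ≠ b ∧ p.2 ≠ s := by simp
  have hle : (st.M.filter fun p => ¬ (p.1 ≠ b ∧ p.2 ≠ s)).card ≤ 1 := by
    rw [card_le_one]
    intro p hp q hq
    simp only [mem_filter, not_and_or, not_not] at hp hq
    rcases h with h | h
    · have key : ∀ r ∈ st.M, r.1 = b ∨ r.2 = s → r.2 = s := fun r hr hr' =>
        hr'.resolve_left fun e => h ⟨r.2, e ▸ hr⟩
      exact hM.2 p hp.1 q hq.1 ((key p hp.1 hp.2).trans (key q hq.1 hq.2).symm)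
    · have key : ∀ r ∈ st.M, r.1 = b ∨ r.2 = s → r.1 = b := fun r hr hr' =>
        hr'.resolve_right fun e => h ⟨r.1, e ▸ hr⟩
      exact hM.1 p hp.1 q hq.1 ((key p hp.1 hp.2).trans (key q hq.1 hq.2).symm)
  have hsum := card_filter_add_card_filter_not (s := st.M) (fun p => p.1 ≠ b ∧ p.2 ≠ s)
  simp only [matchPair, card_insert_of_notMem hni]
  omega

theorem Move2.card_le {Mk : Market B S} {ε : ℝ} {st st' : MState B S} {z : B ⊕ S}
    (h : Move2 Mk ε st z st') (hM : PairsDisjoint st.M) : st.M.card ≤ st'.M.card := by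
  cases h with
  | buyRaise => exact le_rfl
  | buyMatch b s hb => exact card_le_card_matchPair _ hM (Or.inl hb)
  | sellLower => exact le_rfl
  | sellMatch s b hs => exact card_le_card_matchPair _ hM (Or.inr hs)

open Classical in
theorem card_unmatched {st : MState B S} (hM : PairsDisjoint st.M) :
    (univ.filter (Unmatched st)).card + 2 * st.M.card = Fintype.card B + Fintype.card S := by
  have hB : (univ.filter (BMatched st)).card = st.M.card := by
    rw [← card_image_of_injOn (s := st.M) (f := Prod.fst) fun p hp q hq => hM.1 p hp q hq]
    congr 1
    ext b
    simp [BMatched]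
  have hS : (univ.filter (SMatched st)).card = st.M.card := by
    rw [← card_image_of_injOn (s := st.M) (f := Prod.snd) fun p hp q hq => hM.2 p hp q hq]
    congr 1
    ext s
    simp [SMatched]
  have hU : (univ.filter (Unmatched st)).card =
      (univ.filter fun b => ¬ BMatched st b).card +
        (univ.filter fun s => ¬ SMatched st s).card := by
    rw [← card_disjSum]
    congr 1
    ext z
    rcases z with b | s <;>
      simp only [mem_filter_univ, inl_mem_disjSum, inr_mem_disjSum] <;> rfl
  have h₁ := card_filter_add_card_filter_not (s := (univ : Finset B)) (BMatched st)
  have h₂ := card_filter_add_card_filter_not (s := (univ : Finset S)) (SMatched st)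
  rw [card_univ] at h₁ h₂
  omega

theorem mem_activeSet {Mk : Market B S} {ε : ℝ} {st : MState B S} {z : B ⊕ S} :
    z ∈ activeSet Mk ε st ↔ ∃ st', Move2 Mk ε st z st' := by
  simp [activeSet]

theorem inl_mem_activeSet {Mk : Market B S} {ε : ℝ} {st : MState B S} {b : B} {s : S}
    (hE : (b, s) ∈ Mk.E) (hb : ¬ BMatched st b) (hs : ¬ SMatched st s)
    (hle : st.PS s ≤ st.PB b) : Sum.inl b ∈ activeSet Mk ε st :=
  mem_activeSet.2 (exists_buyer_move hb ⟨hE, Or.inl ⟨hs, hle⟩⟩)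

theorem inr_mem_activeSet {Mk : Market B S} {ε : ℝ} {st : MState B S} {b : B} {s : S}
    (hE : (b, s) ∈ Mk.E) (hb : ¬ BMatched st b) (hs : ¬ SMatched st s)
    (hle : st.PS s ≤ st.PB b) : Sum.inr s ∈ activeSet Mk ε st :=
  mem_activeSet.2 (exists_seller_move hs ⟨hE, Or.inl ⟨hb, hle⟩⟩)

theorem NewMatch.of_buyer_move {Mk : Market B S} {ε : ℝ} (hε : 0 < ε) {st st' : MState B S}
    {b : B} {s : S} (h : Move2 Mk ε st (Sum.inl b) st') (hE : (b, s) ∈ Mk.E)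
    (hs : ¬ SMatched st s) (hle : st.PS s ≤ st.PB b) : ∃ s', NewMatch Mk st st' b s' := by
  cases h with
  | buyRaise b hb hv h₁ h₂ => linarith [h₂ s hE hs]
  | buyMatch b s' hb hi hp =>
    exact ⟨s', hi.1, hb, hp ⟨s, ⟨hE, Or.inl ⟨hs, hle⟩⟩, hs⟩, hi.offer_le_bid hε, _, rfl⟩

theorem NewMatch.of_seller_move {Mk : Market B S} {ε : ℝ} (hε : 0 < ε) {st st' : MState B S}
    {b : B} {s : S} (h : Move2 Mk ε st (Sum.inr s) st') (hE : (b, s) ∈ Mk.E)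
    (hb : ¬ BMatched st b) (hle : st.PS s ≤ st.PB b) : ∃ b', NewMatch Mk st st' b' s := by
  cases h with
  | sellLower s hs hv h₁ h₂ => linarith [h₂ b hE hb]
  | sellMatch s b' hs hi hp =>
    exact ⟨b', hi.1, hp ⟨b, ⟨hE, Or.inl ⟨hb, hle⟩⟩, hb⟩, hs, hi.offer_le_bid hε, _, rfl⟩

theorem Move2.pair_intact {Mk : Market B S} {ε : ℝ} (hε : 0 < ε) {st st' : MState B S}
    {z : B ⊕ S} {b : B} {s : S} (h : Move2 Mk ε st z st')
    (hn : ∀ b s, ¬ NewMatch Mk st st' b s) (hE : (b, s) ∈ Mk.E)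
    (hb : ¬ BMatched st b) (hs : ¬ SMatched st s) (hle : st.PS s ≤ st.PB b) :
    ¬ BMatched st' b ∧ ¬ SMatched st' s ∧ st'.PB b = st.PB b ∧ st'.PS s = st.PS s := by
  have hb' : ¬ BMatched st' b := h.unmatched_of_not_newMatch hn (y := Sum.inl b) hb
    (fun b' e _ => Or.inr ⟨s, by cases e; exact ⟨⟨hE, Or.inl ⟨hs, hle⟩⟩, hs⟩⟩)
    (fun s' e => by cases e)
  have hs' : ¬ SMatched st' s := h.unmatched_of_not_newMatch hn (y := Sum.inr s) hs
    (fun b' e => by cases e)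
    (fun s' e _ => Or.inr ⟨b, by cases e; exact ⟨⟨hE, Or.inl ⟨hb, hle⟩⟩, hb⟩⟩)
  refine ⟨hb', hs', ?_⟩
  cases h with
  | buyRaise b₁ h₁ h₂ h₃ h₄ =>
    have hne : b ≠ b₁ := by rintro rfl; linarith [h₄ s hE hs]
    simp [hne]
  | buyMatch b₁ s₁ h₁ h₂ h₃ =>
    have hne : s ≠ s₁ := fun e => hs' (sMatched_matchPair.2 (Or.inl e))
    simp [matchPair, hne]
  | sellLower s₁ h₁ h₂ h₃ h₄ =>
    have hne : s ≠ s₁ := by rintro rfl; linarith [h₄ b hE hb]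
    simp [hne]
  | sellMatch s₁ b₁ h₁ h₂ h₃ =>
    have hne : b ≠ b₁ := fun e => hb' (bMatched_matchPair.2 (Or.inl e))
    simp [matchPair, hne]

theorem Settled.unmatched {Mk : Market B S} {ε : ℝ} {st₀ st : MState B S} {z : B ⊕ S}
    (h : Settled Mk ε st₀ st z) : Unmatched st z := by
  rcases z with b | s <;> exact h.1

/-- When a settled agent moves, he is matched with an unmatched agent. -/
theorem Settled.newMatch {Mk : Market B S} {ε : ℝ} (hε : 0 < ε) {st₀ st st' : MState B S}
    {z : B ⊕ S} (hz : Settled Mk ε st₀ st z) (h : Move2 Mk ε st z st') :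
    ∃ b s, NewMatch Mk st st' b s ∧ (z = Sum.inl b ∨ z = Sum.inr s) := by
  cases h with
  | buyRaise b h₁ h₂ _ _ => exact absurd h₂ (not_le.2 hz.2.1)
  | buyMatch b s h₁ h₂ _ =>
    have hle := hz.2.2.2 s h₂.1
    rcases h₂.2 with h | h
    · exact ⟨b, s, ⟨h₂.1, h₁, h.1, h.2, _, rfl⟩, Or.inl rfl⟩
    · linarith [h.2]
  | sellLower s h₁ h₂ _ _ => exact absurd h₂ (not_le.2 hz.2.1)
  | sellMatch s b h₁ h₂ _ =>
    have hle := hz.2.2.2 b h₂.1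
    rcases h₂.2 with h | h
    · exact ⟨b, s, ⟨h₂.1, h.1, h₁, h.2, _, rfl⟩, Or.inr rfl⟩
    · linarith [h.2]

theorem Move2.unmatched_of_settled {Mk : Market B S} {ε : ℝ} (hε : 0 < ε)
    {st₀ st st' : MState B S} {z y : B ⊕ S} (h : Move2 Mk ε st z st')
    (hn : ∀ b s, ¬ NewMatch Mk st st' b s) (hy : Settled Mk ε st₀ st y) : Unmatched st' y := by
  refine h.unmatched_of_not_newMatch hn hy.unmatched ?_ ?_
  · rintro b rfl -
    exact Or.inl fun s hs _ => by linarith [hy.2.2.2 s hs]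
  · rintro s rfl -
    exact Or.inl fun b hb _ => by linarith [hy.2.2.2 b hb]

theorem add_le_of_lt_of_mulEps {ε x y : ℝ} (hε : 0 < ε) (hx : MulEps ε x) (hy : MulEps ε y)
    (h : x < y) : x + ε ≤ y := by
  obtain ⟨k, rfl⟩ := hx
  obtain ⟨l, rfl⟩ := hy
  have hkl : k < l := by exact_mod_cast lt_of_mul_lt_mul_right h hε.le
  have : ((k : ℝ) + 1) ≤ l := by exact_mod_cast hkl
  nlinarith

theorem settled_of_notMem_activeSet {Mk : Market B S} {ε : ℝ} (hε : 0 < ε) {st : MState B S}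
    (hB : ∀ b, MulEps ε (st.PB b)) (hS : ∀ s, MulEps ε (st.PS s)) {z : B ⊕ S}
    (hz : Unmatched st z) (hna : z ∉ activeSet Mk ε st) : Settled Mk ε st st z := by
  rw [mem_activeSet] at hna
  rcases z with b | s
  · have hlt : ∀ s, (b, s) ∈ Mk.E → ¬ SMatched st s → st.PB b + ε ≤ st.PS s := by
      intro s hE hs
      refine add_le_of_lt_of_mulEps hε (hB b) (hS s) (lt_of_not_ge fun hle => hna ?_)
      exact exists_buyer_move hz ⟨hE, Or.inl ⟨hs, hle⟩⟩
    have hle : ∀ s, (b, s) ∈ Mk.E → st.PB b ≤ st.PS s := by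
      intro s hE
      by_cases hs : SMatched st s
      · by_contra! h
        exact hna (exists_buyer_move hz
          ⟨hE, Or.inr ⟨hs, add_le_of_lt_of_mulEps hε (hS s) (hB b) h⟩⟩)
      · linarith [hlt s hE hs]
    refine ⟨hz, lt_of_not_ge fun hv => hna ?_, rfl, hle⟩
    exact ⟨_, .buyRaise st b hz hv (fun s hE => by linarith [hle s hE]) hlt⟩
  · have hlt : ∀ b, (b, s) ∈ Mk.E → ¬ BMatched st b → st.PB b ≤ st.PS s - ε := by
      intro b hE hb
      have := add_le_of_lt_of_mulEps hε (hB b) (hS s) (lt_of_not_ge fun hle => hna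
        (exists_seller_move hz ⟨hE, Or.inl ⟨hb, hle⟩⟩))
      linarith
    have hle : ∀ b, (b, s) ∈ Mk.E → st.PB b ≤ st.PS s := by
      intro b hE
      by_cases hb : BMatched st b
      · by_contra! h
        exact hna (exists_seller_move hz
          ⟨hE, Or.inr ⟨hb, add_le_of_lt_of_mulEps hε (hS s) (hB b) h⟩⟩)
      · linarith [hlt b hE hb]
    refine ⟨hz, lt_of_not_ge fun hv => hna ?_, rfl, hle⟩
    exact ⟨_, .sellLower st s hz hv (fun b hE => by linarith [hle b hE]) hlt⟩

open Classical in
/-- The unmatched agents having no legal move. -/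
noncomputable def dormantSet (Mk : Market B S) (ε : ℝ) (st : MState B S) : Finset (B ⊕ S) :=
  univ.filter (Unmatched st) \ activeSet Mk ε st

open Classical in
theorem activeSet_subset (Mk : Market B S) (ε : ℝ) (st : MState B S) :
    activeSet Mk ε st ⊆ univ.filter (Unmatched st) := fun z hz => by
  obtain ⟨st', h⟩ := mem_activeSet.1 hz
  simpa using h.unmatched

theorem not_newMatch_of_dormant {Mk : Market B S} {ε : ℝ} {st₀ st st' : MState B S} {b : B}
    {s : S} (h : NewMatch Mk st st' b s) (hb₀ : ¬ BMatched st₀ b) (hs₀ : ¬ SMatched st₀ s)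
    (hb : st.PB b = st₀.PB b) (hs : st.PS s = st₀.PS s)
    (hd : Sum.inl b ∈ dormantSet Mk ε st₀ ∨ Sum.inr s ∈ dormantSet Mk ε st₀) : False := by
  obtain ⟨hE, -, -, hle, -⟩ := h
  rw [hb, hs] at hle
  simp only [dormantSet, mem_sdiff] at hd
  rcases hd with h | h
  · exact h.2 (inl_mem_activeSet hE hb₀ hs₀ hle)
  · exact h.2 (inr_mem_activeSet hE hb₀ hs₀ hle)

theorem unmatched_of_mem_dormantSet {Mk : Market B S} {ε : ℝ} {st : MState B S} {z : B ⊕ S}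
    (h : z ∈ dormantSet Mk ε st) : Unmatched st z := by
  simp only [dormantSet, mem_sdiff, mem_filter_univ] at h
  exact h.1

/-- A set of agents dormant in `st₀` and still settled in `st`. -/
def IsSettledSet (Mk : Market B S) (ε : ℝ) (st₀ st : MState B S) (W : Finset (B ⊕ S)) : Prop :=
  W ⊆ dormantSet Mk ε st₀ ∧ ∀ z ∈ W, Settled Mk ε st₀ st z

theorem IsSettledSet.not_both {Mk : Market B S} {ε : ℝ} {st₀ st st' : MState B S}
    {W : Finset (B ⊕ S)} (hW : IsSettledSet Mk ε st₀ st W) {b : B} {s : S}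
    (h : NewMatch Mk st st' b s) (hb : Sum.inl b ∈ W) (hs : Sum.inr s ∈ W) : False :=
  not_newMatch_of_dormant h (unmatched_of_mem_dormantSet (hW.1 hb))
    (unmatched_of_mem_dormantSet (hW.1 hs)) (hW.2 _ hb).2.2.1 (hW.2 _ hs).2.2.1
    (Or.inl (hW.1 hb))

open Classical in
theorem IsSettledSet.move {Mk : Market B S} {ε : ℝ} (hε : 0 < ε) {st₀ st st' : MState B S}
    {W : Finset (B ⊕ S)} (hW : IsSettledSet Mk ε st₀ st W) {z : B ⊕ S}
    (h : Move2 Mk ε st z st') : IsSettledSet Mk ε st₀ st' (W.filter (Unmatched st')) := by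
  refine ⟨(filter_subset _ _).trans hW.1, fun y hy => ?_⟩
  rw [mem_filter] at hy
  exact h.settled hε (hW.2 y hy.1) hy.2

open Classical in
theorem IsSettledSet.card_le {Mk : Market B S} {ε : ℝ} {st₀ st st' : MState B S}
    {W : Finset (B ⊕ S)} (hW : IsSettledSet Mk ε st₀ st W) {b : B} {s : S}
    (h : NewMatch Mk st st' b s) : W.card ≤ (W.filter (Unmatched st')).card + 1 := by
  have key : ∀ y ∈ W.filter (fun y => ¬ Unmatched st' y), y = Sum.inl b ∨ y = Sum.inr s := by
    intro y hy
    rw [mem_filter] at hy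
    by_contra! hne
    exact hy.2 (h.unmatched (hW.2 y hy.1).unmatched hne.1 hne.2)
  have hle : (W.filter fun y => ¬ Unmatched st' y).card ≤ 1 := by
    rw [card_le_one]
    intro p hp q hq
    have hp' := (mem_filter.1 hp).1
    have hq' := (mem_filter.1 hq).1
    rcases key p hp with rfl | rfl <;> rcases key q hq with rfl | rfl
    · rfl
    · exact (hW.not_both h hp' hq').elim
    · exact (hW.not_both h hq' hp').elim
    · rfl
  have := card_filter_add_card_filter_not (s := W) (Unmatched st')
  omega

/-- The edge `(b, s)` is an active pair of `st₀` and remains so, with unchanged prices. -/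
def PairIntact (Mk : Market B S) (st₀ st : MState B S) (b : B) (s : S) : Prop :=
  (b, s) ∈ Mk.E ∧ ¬ BMatched st₀ b ∧ ¬ SMatched st₀ s ∧ ¬ BMatched st b ∧ ¬ SMatched st s ∧
    st.PB b = st₀.PB b ∧ st.PS s = st₀.PS s ∧ st₀.PS s ≤ st₀.PB b

/-- `st` is a state reachable from `st₀` in which, if the number of active agents has not
dropped below that of `st₀`, recognizing any of at least `i + 2` agents creates a match
between unmatched agents. -/
def Progress (Mk : Market B S) (ε : ℝ) (st₀ st : MState B S) (i : ℕ) : Prop :=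
  PairsDisjoint st.M ∧ ∃ W, IsSettledSet Mk ε st₀ st W ∧
    ((i = 0 ∧ W = dormantSet Mk ε st₀ ∧ st₀.M.card ≤ st.M.card ∧
        ∃ b s, PairIntact Mk st₀ st b s) ∨
      i + 1 + 2 * st₀.M.card + (dormantSet Mk ε st₀).card ≤ 2 * st.M.card + W.card)

theorem Progress.refl {Mk : Market B S} {ε : ℝ} (hε : 0 < ε) {st : MState B S}
    (hgood : GoodState Mk ε st) (hpair : HasActivePair Mk st) : Progress Mk ε st st 0 := by
  obtain ⟨⟨b, s⟩, hE, hb, hs, hle⟩ := hpair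
  refine ⟨hgood.1.1.2, dormantSet Mk ε st, ⟨Subset.rfl, fun z hz => ?_⟩,
    Or.inl ⟨rfl, rfl, le_rfl, b, s, hE, hb, hs, hb, hs, rfl, rfl, hle⟩⟩
  refine settled_of_notMem_activeSet hε hgood.2.2.2.2.1 hgood.2.2.2.2.2
    (unmatched_of_mem_dormantSet hz) ?_
  simp only [dormantSet, mem_sdiff] at hz
  exact hz.2

theorem Progress.move {Mk : Market B S} {ε : ℝ} (hε : 0 < ε) {st₀ st st' : MState B S} {i : ℕ}
    (hP : Progress Mk ε st₀ st i) {z : B ⊕ S} (h : Move2 Mk ε st z st') :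
    Progress Mk ε st₀ st' i := by
  classical
  obtain ⟨hM, W, hW, hi⟩ := hP
  refine ⟨h.pairsDisjoint hM, W.filter (Unmatched st'), hW.move hε h, ?_⟩
  by_cases hn : ∃ b s, NewMatch Mk st st' b s
  · obtain ⟨b, s, hn⟩ := hn
    have h₁ := hn.card
    have h₂ := hW.card_le hn
    right
    rcases hi with ⟨rfl, rfl, hi, -⟩ | hi <;> omega
  · push Not at hn
    have h₁ := h.card_le hM
    rw [filter_true_of_mem fun y hy => h.unmatched_of_settled hε hn (hW.2 y hy)]
    rcases hi with ⟨rfl, hW', hi, b, s, hE, hb₀, hs₀, hb, hs, hPB, hPS, hle⟩ | hi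
    · obtain ⟨k₁, k₂, k₃, k₄⟩ := h.pair_intact hε hn hE hb hs (by rwa [hPB, hPS])
      exact Or.inl ⟨rfl, hW', hi.trans h₁, b, s, hE, hb₀, hs₀, k₁, k₂, k₃.trans hPB,
        k₄.trans hPS, hle⟩
    · right
      omega

theorem Progress.exists_hits {Mk : Market B S} {ε : ℝ} (hε : 0 < ε)
    {σ : MState B S → B ⊕ S → MState B S} (hσ : LegalStrategy Mk ε σ) {st₀ st : MState B S}
    (hM₀ : PairsDisjoint st₀.M) {i : ℕ} (hP : Progress Mk ε st₀ st i)
    (hA : activeCount Mk ε st₀ ≤ activeCount Mk ε st) :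
    ∃ H ⊆ activeSet Mk ε st, i + 2 ≤ H.card ∧ ∀ z ∈ H, Progress Mk ε st₀ (σ st z) (i + 1) := by
  classical
  obtain ⟨hM, W, hW, hi⟩ := hP
  rcases hi with ⟨rfl, rfl, hi, b, s, hE, hb₀, hs₀, hb, hs, hPB, hPS, hle⟩ | hi
  · have hle' : st.PS s ≤ st.PB b := by rwa [hPB, hPS]
    have hbA : Sum.inl b ∈ activeSet Mk ε st := inl_mem_activeSet hE hb hs hle'
    have hsA : Sum.inr s ∈ activeSet Mk ε st := inr_mem_activeSet hE hb hs hle'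
    have hbd : Sum.inl b ∉ dormantSet Mk ε st₀ := fun h => by
      simp only [dormantSet, mem_sdiff] at h
      exact h.2 (inl_mem_activeSet hE hb₀ hs₀ hle)
    have hsd : Sum.inr s ∉ dormantSet Mk ε st₀ := fun h => by
      simp only [dormantSet, mem_sdiff] at h
      exact h.2 (inr_mem_activeSet hE hb₀ hs₀ hle)
    have key : ∀ z st' b' s', Move2 Mk ε st z st' → NewMatch Mk st st' b' s' →
        Sum.inl b' ∉ dormantSet Mk ε st₀ → Sum.inr s' ∉ dormantSet Mk ε st₀ →
        Progress Mk ε st₀ st' (0 + 1) := by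
      intro z st' b' s' h hn hb' hs'
      refine ⟨h.pairsDisjoint hM, _, hW.move hε h, Or.inr ?_⟩
      rw [filter_true_of_mem fun y hy => hn.unmatched (hW.2 y hy).unmatched
        (by rintro rfl; exact hb' hy) (by rintro rfl; exact hs' hy)]
      have := hn.card
      omega
    refine ⟨{Sum.inl b, Sum.inr s}, ?_, by rw [card_pair Sum.inl_ne_inr], ?_⟩
    · simp [insert_subset_iff, hbA, hsA]
    · intro z hz
      simp only [mem_insert, mem_singleton] at hz
      rcases hz with rfl | rfl
      · have h := hσ st _ hbA
        obtain ⟨s', hn⟩ := NewMatch.of_buyer_move hε h hE hs hle'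
        exact key _ _ b s' h hn hbd fun hs' => not_newMatch_of_dormant hn hb₀
          (unmatched_of_mem_dormantSet hs') hPB (hW.2 _ hs').2.2.1 (Or.inr hs')
      · have h := hσ st _ hsA
        obtain ⟨b', hn⟩ := NewMatch.of_seller_move hε h hE hb hle'
        exact key _ _ b' s h hn (fun hb' => not_newMatch_of_dormant hn
          (unmatched_of_mem_dormantSet hb') hs₀ (hW.2 _ hb').2.2.1 hPS (Or.inl hb')) hsd
  · have key : ∀ z st' b s, Move2 Mk ε st z st' → NewMatch Mk st st' b s →
        Progress Mk ε st₀ st' (i + 1) := by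
      intro z st' b s h hn
      refine ⟨h.pairsDisjoint hM, _, hW.move hε h, Or.inr ?_⟩
      have h₁ := hn.card
      have h₂ := hW.card_le hn
      omega
    have hJ : i + 1 ≤ (activeSet Mk ε st ∩ W).card := by
      have h₁ := card_union_add_card_inter (activeSet Mk ε st) W
      have h₂ : (activeSet Mk ε st ∪ W).card ≤ (univ.filter (Unmatched st)).card := by
        refine card_le_card (union_subset (activeSet_subset Mk ε st) fun z hz => ?_)
        simpa using (hW.2 z hz).unmatched
      have h₃ : (dormantSet Mk ε st₀).card + (activeSet Mk ε st₀).card =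
          (univ.filter (Unmatched st₀)).card := by
        rw [dormantSet]
        convert card_sdiff_add_card_eq_card (activeSet_subset Mk ε st₀)
      have h₄ := card_unmatched hM
      have h₅ := card_unmatched hM₀
      rw [activeCount, activeCount] at hA
      omega
    obtain ⟨z, hz⟩ := card_pos.1 (i.succ_pos.trans_le hJ)
    rw [mem_inter] at hz
    obtain ⟨b, s, hn, hz'⟩ := (hW.2 z hz.2).newMatch hε (hσ st z hz.1)
    obtain ⟨hE, hb, hs, hle, -⟩ := id hn
    have partner : ∃ y ∈ activeSet Mk ε st, y ∉ W ∧ Progress Mk ε st₀ (σ st y) (i + 1) := by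
      rcases hz' with rfl | rfl
      · have hy : Sum.inr s ∈ activeSet Mk ε st := inr_mem_activeSet hE hb hs hle
        obtain ⟨b', hn'⟩ := NewMatch.of_seller_move hε (hσ st _ hy) hE hb hle
        exact ⟨_, hy, fun hy' => hW.not_both hn hz.2 hy', key _ _ _ _ (hσ st _ hy) hn'⟩
      · have hy : Sum.inl b ∈ activeSet Mk ε st := inl_mem_activeSet hE hb hs hle
        obtain ⟨s', hn'⟩ := NewMatch.of_buyer_move hε (hσ st _ hy) hE hs hle
        exact ⟨_, hy, fun hy' => hW.not_both hn hy' hz.2, key _ _ _ _ (hσ st _ hy) hn'⟩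
    obtain ⟨y, hyA, hyW, hy⟩ := partner
    refine ⟨insert y (activeSet Mk ε st ∩ W), ?_, ?_, ?_⟩
    · exact insert_subset hyA inter_subset_left
    · rw [card_insert_of_notMem fun h => hyW (mem_inter.1 h).2]
      omega
    · intro x hx
      rcases mem_insert.1 hx with rfl | hx
      · exact hy
      · obtain ⟨hxA, hxW⟩ := mem_inter.1 hx
        obtain ⟨b', s', hn', -⟩ := (hW.2 x hxW).newMatch hε (hσ st x hxA)
        exact key _ _ _ _ (hσ st x hxA) hn'

/-- Probability that the pure birth chain on `ℕ`, which leaves `i` with probability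
`(i + 2) / n`, is still below `n - 1` after the given number of steps from `i`. -/
noncomputable def birthStay (n : ℕ) : ℕ → ℕ → ℝ
  | 0, i => if i + 2 ≤ n then 1 else 0
  | t + 1, i => if i + 2 ≤ n then
      (1 - (i + 2 : ℝ) / n) * birthStay n t i + (i + 2 : ℝ) / n * birthStay n t (i + 1) else 0

theorem birthStay_of_lt {n i : ℕ} (h : n < i + 2) (t : ℕ) : birthStay n t i = 0 := by
  cases t <;> simp [birthStay, not_le.2 h]

theorem birthStay_nonneg (n t i : ℕ) : 0 ≤ birthStay n t i := by
  induction t generalizing i with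
  | zero => unfold birthStay; split_ifs <;> norm_num
  | succ t ih =>
    unfold birthStay
    split_ifs with h
    · have hn : ((i : ℝ) + 2) / n ≤ 1 := div_le_one_of_le₀ (by exact_mod_cast h) (by positivity)
      have := ih i
      have := ih (i + 1)
      have := sub_nonneg.2 hn
      positivity
    · exact le_rfl

theorem birthStay_succ_le (n t i : ℕ) : birthStay n t (i + 1) ≤ birthStay n t i := by
  induction t generalizing i with
  | zero => unfold birthStay; split_ifs <;> first | omega | norm_num
  | succ t ih =>
    by_cases h : i + 1 + 2 ≤ n
    · have h' : i + 2 ≤ n := by omega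
      have h₁ : (((i + 1 : ℕ) : ℝ) + 2) / n ≤ 1 :=
        div_le_one_of_le₀ (by exact_mod_cast h) (by positivity)
      have h₂ : ((i : ℝ) + 2) / n ≤ 1 := div_le_one_of_le₀ (by exact_mod_cast h') (by positivity)
      have h₃ : 0 ≤ (((i + 1 : ℕ) : ℝ) + 2) / n := by positivity
      simp only [birthStay, h, h', if_true]
      nlinarith [mul_nonneg h₃ (sub_nonneg.2 (ih (i + 1))),
        mul_nonneg (sub_nonneg.2 h₂) (sub_nonneg.2 (ih i))]
    · rw [birthStay_of_lt (by omega)]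
      exact birthStay_nonneg _ _ _

theorem sum_birth_step (n : ℝ) (g : ℕ → ℝ) (N : ℕ) :
    ∑ i ∈ range N, ((i : ℝ) + 1) * ((1 - (i + 2) / n) * g i + (i + 2) / n * g (i + 1)) =
      (1 - 2 / n) * ∑ i ∈ range N, ((i : ℝ) + 1) * g i + N * (N + 1) / n * g N := by
  induction N with
  | zero => simp
  | succ N ih =>
    rw [sum_range_succ, ih, sum_range_succ]
    push_cast
    ring

theorem sum_birthStay {n : ℕ} (hn : 1 ≤ n) (t : ℕ) :
    ∑ i ∈ range (n - 1), ((i : ℝ) + 1) * birthStay n t i =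
      (1 - 2 / (n : ℝ)) ^ t * ∑ i ∈ range (n - 1), ((i : ℝ) + 1) := by
  induction t with
  | zero =>
    rw [pow_zero, one_mul]
    refine sum_congr rfl fun i hi => ?_
    have : i + 2 ≤ n := by have := mem_range.1 hi; omega
    simp [birthStay, this]
  | succ t ih =>
    have h := sum_birth_step n (birthStay n t) (n - 1)
    rw [birthStay_of_lt (by omega : n < n - 1 + 2), mul_zero, add_zero, ih] at h
    rw [pow_succ', mul_assoc, ← h]
    refine sum_congr rfl fun i hi => ?_
    have : i + 2 ≤ n := by have := mem_range.1 hi; omega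
    simp [birthStay, this]

theorem birthStay_zero_le {n : ℕ} (hn : 2 ≤ n) (t : ℕ) :
    birthStay n t 0 ≤ (n : ℝ) ^ 2 * (1 - 2 / (n : ℝ)) ^ t := by
  have hn' : (2 : ℝ) ≤ n := by exact_mod_cast hn
  have hpow : 0 ≤ (1 - 2 / (n : ℝ)) ^ t :=
    pow_nonneg (sub_nonneg.2 (div_le_one_of_le₀ hn' (by positivity))) t
  have hsum : ∑ i ∈ range (n - 1), ((i : ℝ) + 1) ≤ (n : ℝ) ^ 2 := by
    calc ∑ i ∈ range (n - 1), ((i : ℝ) + 1) ≤ ∑ i ∈ range (n - 1), (n : ℝ) := by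
          refine sum_le_sum fun i hi => ?_
          have : i + 1 ≤ n := by have := mem_range.1 hi; omega
          exact_mod_cast this
      _ = ((n - 1 : ℕ) : ℝ) * n := by simp
      _ ≤ (n : ℝ) ^ 2 := by
          rw [sq]
          gcongr
          exact n.sub_le 1
  calc birthStay n t 0 = (((0 : ℕ) : ℝ) + 1) * birthStay n t 0 := by simp
    _ ≤ ∑ i ∈ range (n - 1), ((i : ℝ) + 1) * birthStay n t i :=
        single_le_sum (f := fun i : ℕ => ((i : ℝ) + 1) * birthStay n t i)
          (fun i _ => mul_nonneg (by positivity) (birthStay_nonneg n t i))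
          (mem_range.2 (by omega))
    _ ≤ (n : ℝ) ^ 2 * (1 - 2 / (n : ℝ)) ^ t := by
        rw [sum_birthStay (by omega), mul_comm]
        gcongr

theorem birthStay_le_inv_sq {n : ℕ} (hn : 2 ≤ n) {t : ℕ}
    (ht : 2 * (n : ℝ) * Real.log n ≤ t) : birthStay n t 0 ≤ 1 / (n : ℝ) ^ 2 := by
  have hn' : (2 : ℝ) ≤ n := by exact_mod_cast hn
  have hpos : (0 : ℝ) < n := by linarith
  have hbase : 0 ≤ 1 - 2 / (n : ℝ) := sub_nonneg.2 (div_le_one_of_le₀ hn' hpos.le)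
  have hexp : (1 - 2 / (n : ℝ)) ^ t ≤ ((n : ℝ) ^ 4)⁻¹ := by
    calc (1 - 2 / (n : ℝ)) ^ t ≤ Real.exp (-(2 / (n : ℝ))) ^ t :=
          pow_le_pow_left₀ hbase (Real.one_sub_le_exp_neg _) t
      _ = Real.exp (-(2 / (n : ℝ) * t)) := by rw [← Real.exp_nat_mul]; ring_nf
      _ ≤ Real.exp (-(Real.log ((n : ℝ) ^ 4))) := by
          refine Real.exp_le_exp.2 (neg_le_neg ?_)
          rw [Real.log_pow, div_mul_eq_mul_div, le_div_iff₀ hpos]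
          push_cast
          linarith
      _ = ((n : ℝ) ^ 4)⁻¹ := by rw [Real.exp_neg, Real.exp_log (by positivity)]
  calc birthStay n t 0 ≤ (n : ℝ) ^ 2 * (1 - 2 / (n : ℝ)) ^ t := birthStay_zero_le hn t
    _ ≤ (n : ℝ) ^ 2 * ((n : ℝ) ^ 4)⁻¹ := by gcongr
    _ = 1 / (n : ℝ) ^ 2 := by field_simp

/-- Distribution of the reversed trajectory `l` extended by `T` further rounds. -/
noncomputable def extendPath (Mk : Market B S) (ε : ℝ) (σ : MState B S → B ⊕ S → MState B S) :
    ℕ → List (MState B S) → PMF (List (MState B S))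
  | 0, l => PMF.pure l
  | T + 1, l => (stepPMF Mk ε σ l.headI).bind fun st => extendPath Mk ε σ T (st :: l)

theorem pathPMF_bind_extendPath (Mk : Market B S) (ε : ℝ)
    (σ : MState B S → B ⊕ S → MState B S) (st₀ : MState B S) (k T : ℕ) :
    (pathPMF Mk ε σ st₀ T).bind (extendPath Mk ε σ k) = pathPMF Mk ε σ st₀ (T + k) := by
  induction k generalizing T with
  | zero => exact PMF.bind_pure _
  | succ k ih =>
    rw [← add_assoc, add_right_comm, ← ih (T + 1), pathPMF, PMF.bind_bind]
    simp only [PMF.bind_map]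
    rfl

theorem pathPMF_eq_extendPath (Mk : Market B S) (ε : ℝ)
    (σ : MState B S → B ⊕ S → MState B S) (st₀ : MState B S) (T : ℕ) :
    pathPMF Mk ε σ st₀ T = extendPath Mk ε σ T [st₀] := by
  have h := pathPMF_bind_extendPath Mk ε σ st₀ T 0
  rw [zero_add, pathPMF, PMF.pure_bind] at h
  exact h.symm

theorem extendPath_forall_eq_zero (Mk : Market B S) (ε : ℝ)
    (σ : MState B S → B ⊕ S → MState B S) (p : MState B S → Prop) (T : ℕ)
    {l : List (MState B S)} (hl : ¬ ∀ st ∈ l, p st) :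
    (extendPath Mk ε σ T l).toOuterMeasure {l | ∀ st ∈ l, p st} = 0 := by
  induction T generalizing l with
  | zero =>
    rw [extendPath, PMF.toOuterMeasure_pure_apply, if_neg]
    exact hl
  | succ T ih =>
    rw [extendPath, PMF.toOuterMeasure_bind_apply]
    refine ENNReal.tsum_eq_zero.2 fun st => ?_
    rw [ih fun h => hl fun st' hst' => h st' (List.mem_cons_of_mem _ hst'), mul_zero]

theorem birthStay_average_le {α : Type*} [DecidableEq α] {n t i : ℕ} {A H : Finset α} (hHA : H ⊆ A)
    (hH : i + 2 ≤ H.card) (hA : A.card ≤ n) :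
    (∑ a ∈ A, if a ∈ H then birthStay n t (i + 1) else birthStay n t i) / A.card ≤
      birthStay n (t + 1) i := by
  have hHA' := card_le_card hHA
  have hApos : (0 : ℝ) < A.card := by exact_mod_cast (by omega : 0 < A.card)
  have hn : (A.card : ℝ) ≤ n := by exact_mod_cast hA
  have hin : i + 2 ≤ n := by omega
  have hsum : (∑ a ∈ A, if a ∈ H then birthStay n t (i + 1) else birthStay n t i) =
      A.card * birthStay n t i - H.card * (birthStay n t i - birthStay n t (i + 1)) := by
    have : ∀ a ∈ A, (if a ∈ H then birthStay n t (i + 1) else birthStay n t i) =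
        birthStay n t i - if a ∈ H then birthStay n t i - birthStay n t (i + 1) else 0 := by
      intro a _
      split_ifs <;> ring
    rw [sum_congr rfl this, sum_sub_distrib, ← sum_filter, filter_mem_eq_inter,
      inter_eq_right.2 hHA]
    simp [mul_sub]
  have hratio : ((i : ℝ) + 2) / n ≤ H.card / A.card := by
    have : ((i : ℝ) + 2) ≤ H.card := by exact_mod_cast hH
    gcongr
  rw [hsum, sub_div, mul_div_cancel_left₀ _ hApos.ne', mul_div_right_comm]
  simp only [birthStay, hin, if_true]
  nlinarith [mul_nonneg (sub_nonneg.2 hratio) (sub_nonneg.2 (birthStay_succ_le n t i))]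

theorem extendPath_le_birthStay {Mk : Market B S} {ε : ℝ} (hε : 0 < ε)
    {σ : MState B S → B ⊕ S → MState B S} (hσ : LegalStrategy Mk ε σ) {st₀ : MState B S}
    (hM₀ : PairsDisjoint st₀.M) (T : ℕ) {st : MState B S} (l : List (MState B S)) {i : ℕ}
    (hP : Progress Mk ε st₀ st i) :
    (extendPath Mk ε σ T (st :: l)).toOuterMeasure
        {l | ∀ st ∈ l, activeCount Mk ε st₀ ≤ activeCount Mk ε st} ≤
      ENNReal.ofReal (birthStay (Fintype.card B + Fintype.card S) T i) := by
  induction T generalizing st l i with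
  | zero =>
    rw [extendPath, PMF.toOuterMeasure_pure_apply]
    split_ifs with hl
    · obtain ⟨H, hHA, hH, -⟩ := hP.exists_hits hε hσ hM₀ (hl st List.mem_cons_self)
      have hin := hH.trans (card_le_univ H)
      rw [Fintype.card_sum] at hin
      simp [birthStay, hin]
    · exact zero_le
  | succ T ih =>
    by_cases hl : ∀ st' ∈ st :: l, activeCount Mk ε st₀ ≤ activeCount Mk ε st'
    swap
    · rw [extendPath_forall_eq_zero Mk ε σ _ _ hl]
      exact zero_le
    obtain ⟨H, hHA, hH, hH'⟩ := hP.exists_hits hε hσ hM₀ (hl st List.mem_cons_self)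
    have hA : (activeSet Mk ε st).card ≤ Fintype.card B + Fintype.card S := by
      rw [← Fintype.card_sum]
      exact card_le_univ _
    have hApos : 0 < (activeSet Mk ε st).card := by have := card_le_card hHA; omega
    have hne : (activeSet Mk ε st).Nonempty := card_pos.1 hApos
    refine le_trans ?_ (ENNReal.ofReal_le_ofReal (birthStay_average_le hHA hH hA))
    rw [extendPath, List.headI_cons, stepPMF, dif_pos hne, PMF.bind_map,
      PMF.toOuterMeasure_bind_apply, tsum_eq_sum (s := activeSet Mk ε st) fun z hz => by
        rw [PMF.uniformOfFinset_apply_of_notMem hne hz, zero_mul],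
      ENNReal.ofReal_div_of_pos (by exact_mod_cast hApos), ENNReal.ofReal_natCast,
      ENNReal.div_eq_inv_mul,
      ENNReal.ofReal_sum_of_nonneg fun z _ => by split_ifs <;> exact birthStay_nonneg _ _ _,
      mul_sum]
    refine sum_le_sum fun z hz => ?_
    rw [PMF.uniformOfFinset_apply_of_mem hne hz]
    gcongr
    split_ifs with hzH
    · exact ih (st :: l) (hH' z hzH)
    · exact ih (st :: l) (hP.move hε (hσ st z hz))

/-- under Mechanism 2, if the current state has an active pair, then with
probability at least `1 − 1/n²` the number of active agents strictly decreases within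
`2·n·log n` steps. -/
theorem active_pair_decreases_active_count
    (Mk : Market B S) (ε : ℝ) (hε : 0 < ε)
    (σ : MState B S → B ⊕ S → MState B S) (hσ : LegalStrategy Mk ε σ)
    (st₀ : MState B S) (hgood : GoodState Mk ε st₀) (hpair : HasActivePair Mk st₀) :
    ENNReal.ofReal (1 - 1 / (Fintype.card B + Fintype.card S : ℝ) ^ 2) ≤
      (pathPMF Mk ε σ st₀
          ⌈2 * (Fintype.card B + Fintype.card S : ℝ) *
            Real.log (Fintype.card B + Fintype.card S : ℝ)⌉₊).toOuterMeasure
        {l | ∃ st ∈ l, activeCount Mk ε st < activeCount Mk ε st₀} := by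
  obtain ⟨⟨b, s⟩, -⟩ := id hpair
  have hn : 2 ≤ Fintype.card B + Fintype.card S := by
    have := Fintype.card_pos_iff.2 ⟨b⟩
    have := Fintype.card_pos_iff.2 ⟨s⟩
    omega
  rw [pathPMF_eq_extendPath]
  set T := ⌈2 * (Fintype.card B + Fintype.card S : ℝ) *
    Real.log (Fintype.card B + Fintype.card S : ℝ)⌉₊
  set μ := (extendPath Mk ε σ T [st₀]).toOuterMeasure
  have hfail := extendPath_le_birthStay hε hσ hgood.1.1.2 T [] (Progress.refl hε hgood hpair)
  have hbound : birthStay (Fintype.card B + Fintype.card S) T 0 ≤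
      1 / (Fintype.card B + Fintype.card S : ℝ) ^ 2 := by
    have := birthStay_le_inv_sq hn (t := T) (by push_cast; exact Nat.le_ceil _)
    exact_mod_cast this
  have htotal : 1 ≤ μ {l | ∃ st ∈ l, activeCount Mk ε st < activeCount Mk ε st₀} +
      μ {l | ∀ st ∈ l, activeCount Mk ε st₀ ≤ activeCount Mk ε st} := by
    refine le_trans (ge_of_eq ?_) (MeasureTheory.measure_union_le _ _)
    refine (PMF.toOuterMeasure_apply_eq_one_iff _ _).2 fun l _ => ?_
    by_cases h : ∃ st ∈ l, activeCount Mk ε st < activeCount Mk ε st₀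
    · exact Or.inl h
    · push Not at h
      exact Or.inr h
  rw [ENNReal.ofReal_sub _ (by positivity), ENNReal.ofReal_one, tsub_le_iff_right]
  refine htotal.trans (add_le_add_right ?_ _)
  exact hfail.trans (ENNReal.ofReal_le_ofReal hbound)
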